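/- Let f be a C^3 multicritical circle map with N critical points and irrational rotation number α = [a_1, a_2, …], and consider the dynamical partitions P_n associated to a critical point c of f. Suppose M > 1 and n ≥ 1 are such that for all 0 ≤ i < q_n, all 0 ≤ s < r_n and all k_s^{(n)} < j < k_{s+1}^{(n)} one has M^{−1}·|I_{n−1}^i|/min{j − k_s^{(n)}, k_{s+1}^{(n)} − j}^2 < |Δ^{(n)}_{i,j}| < M·|I_{n−1}^i|/min{j − k_s^{(n)}, k_{s+1}^{(n)} − j}^2, where |·| denotes Lebesgue measure. Then for every 0 < γ < 1 and every 0 ≤ i < q_n, one has |A^n_{i,γ}| ≤ (4N + 2)·M·|I_{n−1}^i|/⌊a_{n+1}^γ⌋. -/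

import Mathlib

open MeasureTheory Set Filter
open scoped ENNReal NNReal

noncomputable section

/-- The circle `S¹ = ℝ/ℤ`. -/
abbrev Circle1 := AddCircle (1 : ℝ)

/-- Projection `ℝ → S¹`. -/
def projC (x : ℝ) : Circle1 := (x : Circle1)

/-- An orientation-preserving circle homeomorphism, given together with a
(strictly monotone, continuous) lift `F : ℝ → ℝ` satisfying `F (x+1) = F x + 1`. -/
structure CircleHomeo where
  toHomeo : Circle1 ≃ₜ Circle1
  lift : ℝ → ℝ
  lift_strictMono : StrictMono lift
  lift_continuous : Continuous lift
  lift_add_one : ∀ x : ℝ, lift (x + 1) = lift x + 1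
  lift_proj : ∀ x : ℝ, toHomeo (projC x) = projC (lift x)

/-- The underlying map `S¹ → S¹`. -/
def CircleHomeo.toFun (H : CircleHomeo) : Circle1 → Circle1 := H.toHomeo

/-- `α ∈ [0,1)` is the rotation number of `H`: `α = lim Fⁿ(x)/n (mod 1)`. -/
def HasRotationNumber (H : CircleHomeo) (α : ℝ) : Prop :=
  α ∈ Set.Ico (0 : ℝ) 1 ∧ ∃ β : ℝ, Int.fract β = α ∧
    ∀ x : ℝ, Filter.Tendsto (fun n : ℕ => H.lift^[n] x / n) Filter.atTop (nhds β)

/-- `μ` is an invariant Borel probability measure for `H`. -/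
def IsInvProbMeasure (H : CircleHomeo) (μ : Measure Circle1) : Prop :=
  IsProbabilityMeasure μ ∧ μ.map H.toFun = μ

/-- Hausdorff dimension of a measure: `inf {dim_H X : μ X = 1}`. -/
def dimHMeasure (μ : Measure Circle1) : ℝ≥0∞ :=
  ⨅ (X : Set Circle1) (_ : MeasurableSet X) (_ : μ X = 1), dimH X

/-- The set `D(γ,τ)` of Diophantine numbers of type `(γ,τ)`. -/
def DiophClass (γ τ : ℝ) : Set ℝ :=
  {α : ℝ | ∀ p q : ℤ, q ≠ 0 → γ / |(q : ℝ)| ^ (τ + 2) ≤ |α - (p : ℝ) / (q : ℝ)|}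

/-- The set `D_τ = ⋃_{γ > 0} D(γ,τ)`. -/
def DiophTau (τ : ℝ) : Set ℝ := {α : ℝ | ∃ γ > 0, α ∈ DiophClass γ τ}

/-- Iterates of the Gauss map, starting from `α`. -/
def gaussIter (α : ℝ) : ℕ → ℝ
  | 0 => α
  | n + 1 => Int.fract (1 / gaussIter α n)

/-- The `n`-th partial quotient `a_n` (`n ≥ 1`) of the continued fraction of `α`. -/
def cfA (α : ℝ) (n : ℕ) : ℕ := ⌊1 / gaussIter α (n - 1)⌋₊

/-- Denominators of the convergents: `q_0 = 1`, `q_1 = a_1`, `q_n = a_n q_{n-1} + q_{n-2}`. -/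
def cfQ (α : ℝ) : ℕ → ℕ
  | 0 => 1
  | 1 => cfA α 1
  | n + 2 => cfA α (n + 2) * cfQ α (n + 1) + cfQ α n

/-- Positive displacement from `a` to `z` on the circle, a number in `[0,1)`. -/
def circDisp (a z : Circle1) : ℝ := (AddCircle.equivIco 1 0 (z - a)).1

/-- The circle arc `[a, b)`. -/
def arcIco (a b : Circle1) : Set Circle1 := {z : Circle1 | circDisp a z < circDisp a b}

namespace DynPart

/-- `x_i = f^i(x_0)`. -/
def pt (H : CircleHomeo) (x0 : Circle1) (i : ℕ) : Circle1 := H.toFun^[i] x0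

/-- The interval `I_n`: `[x_0, x_{q_n})` for even `n`, `[x_{q_n}, x_0)` for odd `n`. -/
def In (H : CircleHomeo) (α : ℝ) (x0 : Circle1) (n : ℕ) : Set Circle1 :=
  if Even n then arcIco x0 (pt H x0 (cfQ α n)) else arcIco (pt H x0 (cfQ α n)) x0

/-- `I_n^i = f^i(I_n)`. -/
def Ini (H : CircleHomeo) (α : ℝ) (x0 : Circle1) (n i : ℕ) : Set Circle1 :=
  H.toFun^[i] '' In H α x0 n

/-- The dynamical partition `P_n(x_0)`. -/
def part (H : CircleHomeo) (α : ℝ) (x0 : Circle1) (n : ℕ) : Set (Set Circle1) :=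
  {S | ∃ i < cfQ α n, S = Ini H α x0 (n - 1) i} ∪
  {S | ∃ i < cfQ α (n - 1), S = Ini H α x0 n i}

/-- `Δ^{(n)}_{i,j} = I_n^{i + q_{n-1} + j q_n}`. -/
def Δ (H : CircleHomeo) (α : ℝ) (x0 : Circle1) (n i j : ℕ) : Set Circle1 :=
  Ini H α x0 n (i + cfQ α (n - 1) + j * cfQ α n)

end DynPart

/-- `φ` is a `C³` diffeomorphism from the open set `U` onto the open set `V`. -/
def IsC3DiffeoOn (φ : ℝ → ℝ) (U V : Set ℝ) : Prop :=
  IsOpen U ∧ IsOpen V ∧ ContDiffOn ℝ 3 φ U ∧ Set.BijOn φ U V ∧ ∀ x ∈ U, deriv φ x ≠ 0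

/-- `c` is a critical point of power-law type with exponent `p`: in suitable `C³`
coordinates around `c` and `H c`, the map takes the form `x ↦ x |x|^{p-1}`. -/
def IsPowerLawCritPt (H : CircleHomeo) (c p : ℝ) : Prop :=
  ∃ (U V U' V' : Set ℝ) (φ ψ : ℝ → ℝ),
    c ∈ U ∧ H.lift c ∈ U' ∧ (0 : ℝ) ∈ V ∧ (0 : ℝ) ∈ V' ∧
    IsC3DiffeoOn φ U V ∧ IsC3DiffeoOn ψ U' V' ∧
    φ c = 0 ∧ ψ (H.lift c) = 0 ∧ Set.MapsTo H.lift U U' ∧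
    ∀ x ∈ U, ψ (H.lift x) = φ x * |φ x| ^ (p - 1)

/-- A `C³` multicritical circle map: an orientation-preserving `C³` circle
homeomorphism whose critical points are exactly `c_0, …, c_{N-1}` (represented in
`[0,1)`), each of power-law type with criticality `p_i > 1`. -/
structure MulticriticalCircleMap extends CircleHomeo where
  smooth : ContDiff ℝ 3 lift
  N : ℕ
  N_pos : 0 < N
  crit : Fin N → ℝ
  crit_mem : ∀ i, crit i ∈ Set.Ico (0 : ℝ) 1
  crit_inj : Function.Injective crit
  critExp : Fin N → ℝ
  critExp_gt_one : ∀ i, 1 < critExp i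
  crit_powerLaw : ∀ i, IsPowerLawCritPt toCircleHomeo (crit i) (critExp i)
  crit_complete : ∀ x : ℝ, deriv lift x = 0 → ∃ (i : Fin N) (k : ℤ), x = crit i + (k : ℝ)

/-- `z ∈ S¹` is a critical point of `f^m`. -/
def IsCritPtOfIter (f : MulticriticalCircleMap) (m : ℕ) (z : Circle1) : Prop :=
  ∃ x : ℝ, projC x = z ∧ deriv (f.lift^[m]) x = 0

/-- Indices `0 < j < a_{n+1} - 1` such that the closure of `Δ_j^{(n)}` contains a
critical point of `T_n = f^{q_n}`. -/
def critTimesSet (f : MulticriticalCircleMap) (α : ℝ) (x0 : Circle1) (n : ℕ) : Finset ℕ :=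
  @Finset.filter ℕ
    (fun j => ∃ z ∈ closure (DynPart.Δ f.toCircleHomeo α x0 n 0 j),
      IsCritPtOfIter f (cfQ α n) z)
    (Classical.decPred _)
    (Finset.Ioo 0 (cfA α (n + 1) - 1))

/-- The number `r_n` of bridges (`r_n = #{interior critical times} + 1`). -/
def rn (f : MulticriticalCircleMap) (α : ℝ) (x0 : Circle1) (n : ℕ) : ℕ :=
  (critTimesSet f α x0 n).card + 1

/-- The critical times `0 = k_0^{(n)} < k_1^{(n)} < … < k_{r_n}^{(n)} = a_{n+1} - 1`. -/
def kTime (f : MulticriticalCircleMap) (α : ℝ) (x0 : Circle1) (n : ℕ) (s : ℕ) : ℕ :=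
  (((0 : ℕ) :: (critTimesSet f α x0 n).sort (· ≤ ·)) ++ [cfA α (n + 1) - 1]).getD s
    (cfA α (n + 1) - 1)

/-- The `s`-th bridge `G_s^{(n)} = ⋃_{k_s < j < k_{s+1}} Δ_j^{(n)}`. -/
def bridge (f : MulticriticalCircleMap) (α : ℝ) (x0 : Circle1) (n s : ℕ) : Set Circle1 :=
  ⋃ j ∈ Set.Ioo (kTime f α x0 n s) (kTime f α x0 n (s + 1)),
    DynPart.Δ f.toCircleHomeo α x0 n 0 j

/-- The trimmed bridge `G_{s,γ}^{(n)}`. -/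
def bridgeGamma (f : MulticriticalCircleMap) (α : ℝ) (x0 : Circle1) (n : ℕ) (γ : ℝ)
    (s : ℕ) : Set Circle1 :=
  ⋃ j ∈ {j : ℕ | (kTime f α x0 n s : ℝ) + (cfA α (n + 1) : ℝ) ^ γ < (j : ℝ) ∧
      (j : ℝ) < (kTime f α x0 n (s + 1) : ℝ) + 1 - (cfA α (n + 1) : ℝ) ^ γ},
    DynPart.Δ f.toCircleHomeo α x0 n 0 j

/-- `A^n_{i,γ} = ⋃_{s < r_n} f^i(G_{s,γ}^{(n)})`. -/
def Aset (f : MulticriticalCircleMap) (α : ℝ) (x0 : Circle1) (n i : ℕ) (γ : ℝ) :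
    Set Circle1 :=
  ⋃ s ∈ Set.Iio (rn f α x0 n), f.toCircleHomeo.toFun^[i] '' bridgeGamma f α x0 n γ s

/-- `A^n_γ = ⋃_{i < q_n} A^n_{i,γ}`. -/
def AsetAll (f : MulticriticalCircleMap) (α : ℝ) (x0 : Circle1) (n : ℕ) (γ : ℝ) :
    Set Circle1 :=
  ⋃ i ∈ Set.Iio (cfQ α n), Aset f α x0 n i γ

/-- The Schwarzian derivative `Sf = f'''/f' - (3/2)(f''/f')²`. -/
def schwarzianAt (f : ℝ → ℝ) (x : ℝ) : ℝ :=
  iteratedDeriv 3 f x / deriv f x - 3 / 2 * (iteratedDeriv 2 f x / deriv f x) ^ 2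

end

section ContinuedFraction

variable {α : ℝ}

lemma irrational_gaussIter (hα : Irrational α) (n : ℕ) : Irrational (gaussIter α n) := by
  induction n with
  | zero => exact hα
  | succ n ih =>
    have h : Irrational (1 / gaussIter α n) := by simpa using ih.inv
    exact h.sub_intCast _

lemma gaussIter_pos (hα : Irrational α) (h0 : 0 ≤ α) (n : ℕ) : 0 < gaussIter α n := by
  refine lt_of_le_of_ne ?_ (irrational_gaussIter hα n).ne_zero.symm
  cases n with
  | zero => exact h0
  | succ n => exact Int.fract_nonneg _

lemma gaussIter_lt_one (h1 : α < 1) (n : ℕ) : gaussIter α n < 1 := by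
  cases n with
  | zero => exact h1
  | succ n => exact Int.fract_lt_one _

lemma cfA_succ_pos (hα : Irrational α) (h : α ∈ Set.Ico (0 : ℝ) 1) (n : ℕ) :
    0 < cfA α (n + 1) := by
  have h0 := gaussIter_pos hα h.1 n
  have h1 := gaussIter_lt_one h.2 n
  exact Nat.floor_pos.2 ((one_le_div h0).2 h1.le)

lemma gaussIter_succ_eq (hα : Irrational α) (h0 : 0 ≤ α) (n : ℕ) :
    gaussIter α (n + 1) = 1 / gaussIter α n - cfA α (n + 1) := by
  have h := gaussIter_pos hα h0 n
  have h2 : (0 : ℝ) ≤ 1 / gaussIter α n := by positivity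
  change 1 / gaussIter α n - (⌊1 / gaussIter α n⌋ : ℝ) = _
  rw [← natCast_floor_eq_intCast_floor h2]
  rfl

/-- The distance `|q_n α - p_n|`, as a product of iterates of the Gauss map. -/
noncomputable def cfDist (α : ℝ) : ℕ → ℝ
  | 0 => α
  | n + 1 => cfDist α n * gaussIter α (n + 1)

/-- Numerators of the convergents of `α + k`, for an integer `k`. -/
noncomputable def cfNum (α : ℝ) (k : ℤ) : ℕ → ℤ
  | 0 => k
  | 1 => cfA α 1 * k + 1
  | n + 2 => cfA α (n + 2) * cfNum α k (n + 1) + cfNum α k n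

lemma cfDist_pos (hα : Irrational α) (h0 : 0 ≤ α) (n : ℕ) : 0 < cfDist α n := by
  induction n with
  | zero => exact gaussIter_pos hα h0 0
  | succ n ih => exact mul_pos ih (gaussIter_pos hα h0 _)

lemma cfDist_lt_one (hα : Irrational α) (h : α ∈ Set.Ico (0 : ℝ) 1) (n : ℕ) :
    cfDist α n < 1 := by
  induction n with
  | zero => exact h.2
  | succ n ih =>
    exact mul_lt_one_of_nonneg_of_lt_one_left (cfDist_pos hα h.1 n).le ih
      (gaussIter_lt_one h.2 _).le

lemma cfDist_add_two (hα : Irrational α) (h0 : 0 ≤ α) (n : ℕ) :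
    cfDist α n = cfA α (n + 2) * cfDist α (n + 1) + cfDist α (n + 2) := by
  have h := gaussIter_pos hα h0 (n + 1)
  simp only [cfDist, gaussIter_succ_eq hα h0 (n + 1)]
  field_simp
  ring

lemma cfDist_zero_one (hα : Irrational α) (h0 : 0 ≤ α) :
    1 = cfA α 1 * cfDist α 0 + cfDist α 1 := by
  have h : 0 < α := gaussIter_pos hα h0 0
  simp only [cfDist, gaussIter_succ_eq hα h0 0]
  simp only [gaussIter]
  field_simp
  ring

lemma cfQ_pos (hα : Irrational α) (h : α ∈ Set.Ico (0 : ℝ) 1) (n : ℕ) : 0 < cfQ α n := by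
  induction n using Nat.twoStepInduction with
  | zero => exact Nat.one_pos
  | one => exact cfA_succ_pos hα h 0
  | more n ih _ => exact Nat.add_pos_right _ ih

lemma cfQ_mul_sub_cfNum (hα : Irrational α) (h0 : 0 ≤ α) (k : ℤ) (n : ℕ) :
    cfQ α n * (α + k) - cfNum α k n = (-1) ^ n * cfDist α n := by
  induction n using Nat.twoStepInduction with
  | zero => simp [cfQ, cfNum, cfDist]
  | one =>
    have h := cfDist_zero_one hα h0
    simp only [cfQ, cfNum, cfDist] at h ⊢
    push_cast
    linear_combination -h
  | more n ih1 ih2 =>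
    have h := cfDist_add_two hα h0 n
    simp only [cfQ, cfNum]
    push_cast
    rw [pow_succ] at ih2
    rw [pow_add]
    linear_combination cfA α (n + 2) * ih2 + ih1 + (-1) ^ n * h

lemma cfQ_mul_cfNum_sub (α : ℝ) (k : ℤ) (n : ℕ) :
    cfQ α n * cfNum α k (n + 1) - cfQ α (n + 1) * cfNum α k n = (-1) ^ n := by
  induction n with
  | zero => simp [cfQ, cfNum]
  | succ n ih =>
    simp only [cfQ, cfNum]
    push_cast
    rw [pow_succ]
    linear_combination -ih

/-- Convergents are best approximations. -/
lemma cfDist_le_abs (hα : Irrational α) (h : α ∈ Set.Ico (0 : ℝ) 1) (k : ℤ) (n : ℕ)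
    {t : ℕ} (ht : 0 < t) (htn : t < cfQ α (n + 1)) (b : ℤ) :
    cfDist α n ≤ |t * (α + k) + b| := by
  have hdet := cfQ_mul_cfNum_sub α k n
  obtain ⟨u, hu⟩ : ∃ u : ℤ, u = (-1) ^ n * (t * cfNum α k (n + 1) + b * cfQ α (n + 1)) :=
    ⟨_, rfl⟩
  obtain ⟨v, hv⟩ : ∃ v : ℤ, v = (-1) ^ n * (-b * cfQ α n - t * cfNum α k n) := ⟨_, rfl⟩
  have hD : ((-1 : ℤ) ^ n) * (-1) ^ n = 1 := by rw [← mul_pow]; simp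
  have e1 : (t : ℤ) = u * cfQ α n + v * cfQ α (n + 1) := by
    subst hu hv
    linear_combination (-(t : ℤ)) * hD - (-1) ^ n * t * hdet
  have e2 : -b = u * cfNum α k n + v * cfNum α k (n + 1) := by
    subst hu hv
    linear_combination b * hD + (-1) ^ n * b * hdet
  have q0 := cfQ_pos hα h n
  have q1 := cfQ_pos hα h (n + 1)
  have d0 := cfDist_pos hα h.1 n
  have d1 := cfDist_pos hα h.1 (n + 1)
  have e3 : t * (α + k) + b = (-1) ^ n * (u * cfDist α n - v * cfDist α (n + 1)) := by
    have r1 : (t : ℝ) = u * cfQ α n + v * cfQ α (n + 1) := by exact_mod_cast e1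
    have r2 : -(b : ℝ) = u * cfNum α k n + v * cfNum α k (n + 1) := by exact_mod_cast e2
    have r3 := cfQ_mul_sub_cfNum hα h.1 k n
    have r4 := cfQ_mul_sub_cfNum hα h.1 k (n + 1)
    rw [pow_succ] at r4
    linear_combination (α + k) * r1 - r2 + u * r3 + v * r4
  rw [e3, abs_mul, abs_pow, abs_neg, abs_one, one_pow, one_mul]
  have q0' : (0 : ℤ) < cfQ α n := by exact_mod_cast q0
  have q1' : (0 : ℤ) < cfQ α (n + 1) := by exact_mod_cast q1
  have ht' : (0 : ℤ) < t := by exact_mod_cast ht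
  have htn' : (t : ℤ) < cfQ α (n + 1) := by exact_mod_cast htn
  rcases lt_trichotomy u 0 with hu0 | hu0 | hu0
  · have hv0 : 0 < v := by
      by_contra! hv0
      nlinarith
    have hu1 : (u : ℝ) ≤ -1 := by exact_mod_cast (by omega : u ≤ -1)
    have hv1 : (0 : ℝ) < v := by exact_mod_cast hv0
    rw [le_abs]
    right
    nlinarith
  · exfalso
    rw [hu0, zero_mul, zero_add] at e1
    have hv0 : 0 < v := by
      by_contra! hv0
      nlinarith
    nlinarith
  · have hv0 : v ≤ 0 := by
      by_contra! hv0
      nlinarith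
    have hu1 : (1 : ℝ) ≤ u := by exact_mod_cast (by omega : 1 ≤ u)
    have hv1 : (v : ℝ) ≤ 0 := by exact_mod_cast hv0
    rw [le_abs]
    left
    nlinarith

end ContinuedFraction

section Orbits

namespace CircleHomeo

variable (H : CircleHomeo)

lemma lift_iterate_strictMono (m : ℕ) : StrictMono H.lift^[m] :=
  H.lift_strictMono.iterate m

lemma lift_iterate_add_int (m : ℕ) (x : ℝ) (b : ℤ) :
    H.lift^[m] (x + b) = H.lift^[m] x + b := by
  let g : CircleDeg1Lift := ⟨⟨H.lift, H.lift_strictMono.monotone⟩, H.lift_add_one⟩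
  induction m generalizing x with
  | zero => rfl
  | succ m ih =>
    rw [Function.iterate_succ_apply, Function.iterate_succ_apply,
      show H.lift (x + b) = H.lift x + b from g.map_add_int x b, ih]

lemma toFun_iterate_projC (m : ℕ) (x : ℝ) :
    H.toFun^[m] (projC x) = projC (H.lift^[m] x) := by
  induction m generalizing x with
  | zero => rfl
  | succ m ih =>
    rw [Function.iterate_succ_apply, Function.iterate_succ_apply,
      show H.toFun (projC x) = projC (H.lift x) from H.lift_proj x, ih]

variable {H} {β : ℝ}

lemma lift_iterate_le_mul {t : ℕ} {b : ℤ} {y : ℝ} (h : H.lift^[t] y + b ≤ y) (k : ℕ) :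
    H.lift^[t * k] y + k * b ≤ y := by
  induction k with
  | zero => simp
  | succ k ih =>
    have h1 : H.lift^[t * k] (H.lift^[t] y) + b ≤ H.lift^[t * k] y := by
      rw [← H.lift_iterate_add_int]
      exact (H.lift_iterate_strictMono _).monotone h
    rw [mul_add_one, Function.iterate_add_apply]
    push_cast
    linarith

lemma le_lift_iterate_mul {t : ℕ} {b : ℤ} {y : ℝ} (h : y ≤ H.lift^[t] y + b) (k : ℕ) :
    y ≤ H.lift^[t * k] y + k * b := by
  induction k with
  | zero => simp
  | succ k ih =>
    have h1 : H.lift^[t * k] y ≤ H.lift^[t * k] (H.lift^[t] y) + b := by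
      rw [← H.lift_iterate_add_int]
      exact (H.lift_iterate_strictMono _).monotone h
    rw [mul_add_one, Function.iterate_add_apply]
    push_cast
    linarith

lemma tendsto_lift_iterate_mul {y : ℝ}
    (hβ : Tendsto (fun n : ℕ => H.lift^[n] y / n) atTop (nhds β)) {t : ℕ} (ht : 0 < t) (b : ℤ) :
    Tendsto (fun k : ℕ => (H.lift^[t * k] y + k * b) / k) atTop (nhds (t * β + b)) := by
  have h1 : Tendsto (fun k : ℕ => t * k) atTop atTop :=
    tendsto_id.const_mul_atTop' ht
  have h2 := ((hβ.comp h1).const_mul (t : ℝ)).add_const (b : ℝ)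
  refine h2.congr' ?_
  filter_upwards [eventually_gt_atTop 0] with k hk
  have : (k : ℝ) ≠ 0 := by positivity
  have : (t : ℝ) ≠ 0 := by positivity
  simp only [Function.comp_apply, Nat.cast_mul]
  field_simp

lemma lt_lift_iterate_add {y : ℝ}
    (hβ : Tendsto (fun n : ℕ => H.lift^[n] y / n) atTop (nhds β)) {t : ℕ} {b : ℤ}
    (h : 0 < t * β + b) : y < H.lift^[t] y + b := by
  by_contra! hc
  rcases Nat.eq_zero_or_pos t with rfl | ht
  · simp at h hc
    exact absurd h (not_lt.2 hc)
  have h1 := tendsto_lift_iterate_mul hβ ht b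
  have h2 : Tendsto (fun k : ℕ => y / (k : ℝ)) atTop (nhds 0) :=
    tendsto_const_div_atTop_nhds_zero_nat y
  exact absurd h (not_lt.2 (le_of_tendsto_of_tendsto' h1 h2 fun k =>
    div_le_div_of_nonneg_right (lift_iterate_le_mul hc k) k.cast_nonneg))

lemma lift_iterate_add_lt {y : ℝ}
    (hβ : Tendsto (fun n : ℕ => H.lift^[n] y / n) atTop (nhds β)) {t : ℕ} {b : ℤ}
    (h : t * β + b < 0) : H.lift^[t] y + b < y := by
  by_contra! hc
  rcases Nat.eq_zero_or_pos t with rfl | ht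
  · simp at h hc
    exact absurd h (not_lt.2 hc)
  have h1 := tendsto_lift_iterate_mul hβ ht b
  have h2 : Tendsto (fun k : ℕ => y / (k : ℝ)) atTop (nhds 0) :=
    tendsto_const_div_atTop_nhds_zero_nat y
  exact absurd h (not_lt.2 (le_of_tendsto_of_tendsto' h2 h1 fun k =>
    div_le_div_of_nonneg_right (le_lift_iterate_mul hc k) k.cast_nonneg))

lemma orbit_lt_of_lt
    (hβ : ∀ y : ℝ, Tendsto (fun n : ℕ => H.lift^[n] y / n) atTop (nhds β)) (x : ℝ)
    {a c : ℕ} {b d : ℤ} (h : a * β + b < c * β + d) :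
    H.lift^[a] x + b < H.lift^[c] x + d := by
  rcases le_total a c with hac | hac
  · obtain ⟨t, rfl⟩ := Nat.exists_eq_add_of_le' hac
    have := lt_lift_iterate_add (hβ (H.lift^[a] x)) (t := t) (b := d - b)
      (by push_cast at h ⊢; linarith)
    rw [Function.iterate_add_apply]
    push_cast at this
    linarith
  · obtain ⟨t, rfl⟩ := Nat.exists_eq_add_of_le' hac
    have := lift_iterate_add_lt (hβ (H.lift^[c] x)) (t := t) (b := b - d)
      (by push_cast at h ⊢; linarith)
    rw [Function.iterate_add_apply]
    push_cast at this
    linarith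

/-- The orbits of `H` are ordered as those of the rotation by its irrational rotation number. -/
lemma orbit_lt_iff (hirr : Irrational β)
    (hβ : ∀ y : ℝ, Tendsto (fun n : ℕ => H.lift^[n] y / n) atTop (nhds β)) (x : ℝ)
    {a c : ℕ} {b d : ℤ} :
    H.lift^[a] x + b < H.lift^[c] x + d ↔ a * β + b < c * β + d := by
  refine ⟨fun h => ?_, orbit_lt_of_lt hβ x⟩
  by_contra! hc
  rcases hc.lt_or_eq with hc | hc
  · exact lt_asymm h (orbit_lt_of_lt hβ x hc)
  · have hac : a = c := by
      by_contra hne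
      have hz : (a : ℤ) - c ≠ 0 := by omega
      refine (hirr.intCast_mul hz).ne_int (d - b) ?_
      push_cast
      linarith
    subst hac
    have : (b : ℝ) = d := by linarith
    rw [this] at h
    exact lt_irrefl _ h

end CircleHomeo

end Orbits

section Arcs

lemma projC_add_int (x : ℝ) (b : ℤ) : projC (x + b) = projC x := by
  refine QuotientAddGroup.eq_iff_sub_mem.2 (AddSubgroup.mem_zmultiples_iff.2 ⟨b, ?_⟩)
  simp

lemma exists_int_of_projC_eq {x y : ℝ} (h : projC x = projC y) : ∃ b : ℤ, x = y + b := by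
  obtain ⟨b, hb⟩ := AddSubgroup.mem_zmultiples_iff.1 (QuotientAddGroup.eq_iff_sub_mem.1 h)
  refine ⟨b, ?_⟩
  simp only [zsmul_eq_mul, mul_one] at hb
  linarith

lemma circDisp_projC (u w : ℝ) : circDisp (projC u) (projC w) = Int.fract (w - u) := by
  have h := AddCircle.coe_equivIco_mk_apply (p := (1 : ℝ)) (w - u)
  simp only [div_one, mul_one] at h
  exact h

lemma arcIco_projC {u v : ℝ} (huv : u < v) (hv : v < u + 1) :
    arcIco (projC u) (projC v) = projC '' Ico u v := by
  have hfr : Int.fract (v - u) = v - u :=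
    Int.fract_eq_self.2 ⟨by linarith, by linarith⟩
  ext z
  constructor
  · obtain ⟨w, rfl⟩ : ∃ w, projC w = z := QuotientAddGroup.mk_surjective z
    intro hz
    simp only [arcIco, mem_ofPred_eq, circDisp_projC, hfr] at hz
    refine ⟨u + Int.fract (w - u), ⟨by linarith [Int.fract_nonneg (w - u)], by linarith⟩, ?_⟩
    rw [← projC_add_int _ ⌊w - u⌋]
    congr 1
    linarith [Int.fract_add_floor (w - u)]
  · rintro ⟨w, hw, rfl⟩
    simp only [arcIco, mem_ofPred_eq, circDisp_projC, hfr]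
    rw [Int.fract_eq_self.2 ⟨by linarith [hw.1], by linarith [hw.2]⟩]
    linarith [hw.2]

lemma closure_projC_image_subset (u v : ℝ) :
    closure (projC '' Ico u v) ⊆ projC '' Icc u v := by
  have hc : Continuous projC := AddCircle.continuous_mk' 1
  exact closure_minimal (image_mono Ico_subset_Icc_self) (isCompact_Icc.image hc).isClosed

end Arcs

section DynamicalPartition

variable {H : CircleHomeo} {α : ℝ} {k : ℤ}

/-- Lifts of the successive endpoints of the atoms `Δ^{(n+1)}_j`, as seen from `x`. -/
noncomputable def atomEnd (H : CircleHomeo) (α : ℝ) (k : ℤ) (x : ℝ) (n j : ℕ) : ℝ :=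
  H.lift^[cfQ α n + j * cfQ α (n + 1)] x + (-(cfNum α k n + j * cfNum α k (n + 1)) : ℤ)

lemma rotation_atomEnd (hα : Irrational α) (h0 : 0 ≤ α) (k : ℤ) (n j : ℕ) :
    ((cfQ α n + j * cfQ α (n + 1) : ℕ) : ℝ) * (α + k) +
        (-(cfNum α k n + j * cfNum α k (n + 1)) : ℤ) =
      (-1) ^ n * (cfDist α n - j * cfDist α (n + 1)) := by
  have r3 := cfQ_mul_sub_cfNum hα h0 k n
  have r4 := cfQ_mul_sub_cfNum hα h0 k (n + 1)
  rw [pow_succ] at r4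
  push_cast
  linear_combination r3 + j * r4

lemma atomEnd_lt_iff (hα : Irrational α) (h : α ∈ Set.Ico (0 : ℝ) 1)
    (hβ : ∀ y : ℝ, Tendsto (fun n : ℕ => H.lift^[n] y / n) atTop (nhds (α + k)))
    (x : ℝ) (n j t : ℕ) (b : ℤ) :
    atomEnd H α k x n j < H.lift^[t] x + b ↔
      (-1) ^ n * (cfDist α n - j * cfDist α (n + 1)) < t * (α + k) + b := by
  rw [atomEnd, CircleHomeo.orbit_lt_iff (hα.add_intCast k) hβ, rotation_atomEnd hα h.1]

lemma lt_atomEnd_iff (hα : Irrational α) (h : α ∈ Set.Ico (0 : ℝ) 1)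
    (hβ : ∀ y : ℝ, Tendsto (fun n : ℕ => H.lift^[n] y / n) atTop (nhds (α + k)))
    (x : ℝ) (n j t : ℕ) (b : ℤ) :
    H.lift^[t] x + b < atomEnd H α k x n j ↔
      t * (α + k) + b < (-1) ^ n * (cfDist α n - j * cfDist α (n + 1)) := by
  rw [atomEnd, CircleHomeo.orbit_lt_iff (hα.add_intCast k) hβ, rotation_atomEnd hα h.1]

lemma atomEnd_zero (x : ℝ) (n : ℕ) :
    atomEnd H α k x n 0 = H.lift^[cfQ α n] x + (-cfNum α k n : ℤ) := by
  simp [atomEnd]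

lemma max_lt_min_add_one (hα : Irrational α) (h : α ∈ Set.Ico (0 : ℝ) 1)
    (hβ : ∀ y : ℝ, Tendsto (fun n : ℕ => H.lift^[n] y / n) atTop (nhds (α + k)))
    (x : ℝ) (n : ℕ) :
    max x (atomEnd H α k x n 0) < min x (atomEnd H α k x n 0) + 1 := by
  have d0 := cfDist_pos hα h.1 n
  have d1 := cfDist_lt_one hα h n
  have hlt : atomEnd H α k x n 0 < x + 1 := by
    simpa using (atomEnd_lt_iff hα h hβ x n 0 0 1).2 (by
      rcases neg_one_pow_eq_or ℝ n with hn | hn <;> simp [hn] <;> linarith)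
  have hgt : x + (-1) < atomEnd H α k x n 0 := by
    simpa using (lt_atomEnd_iff hα h hβ x n 0 0 (-1)).2 (by
      rcases neg_one_pow_eq_or ℝ n with hn | hn <;> simp [hn] <;> linarith)
  rcases le_total x (atomEnd H α k x n 0) with hle | hle
  · rwa [min_eq_left hle, max_eq_right hle]
  · rw [min_eq_right hle, max_eq_left hle]
    linarith

lemma In_eq (hα : Irrational α) (h : α ∈ Set.Ico (0 : ℝ) 1)
    (hβ : ∀ y : ℝ, Tendsto (fun n : ℕ => H.lift^[n] y / n) atTop (nhds (α + k)))
    (x : ℝ) (n : ℕ) :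
    DynPart.In H α (projC x) n =
      projC '' Ico (min x (atomEnd H α k x n 0)) (max x (atomEnd H α k x n 0)) := by
  have hpt : DynPart.pt H (projC x) (cfQ α n) = projC (atomEnd H α k x n 0) := by
    rw [DynPart.pt, H.toFun_iterate_projC, atomEnd_zero, projC_add_int]
  have d0 := cfDist_pos hα h.1 n
  have hlen := max_lt_min_add_one hα h hβ x n
  rw [DynPart.In, hpt]
  split_ifs with hn
  · have h1 : x < atomEnd H α k x n 0 := by
      simpa using (lt_atomEnd_iff hα h hβ x n 0 0 0).2 (by simpa [hn.neg_one_pow] using d0)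
    rw [min_eq_left h1.le, max_eq_right h1.le] at hlen ⊢
    rw [arcIco_projC h1 hlen]
  · have hn' := Nat.not_even_iff_odd.1 hn
    have h1 : atomEnd H α k x n 0 < x := by
      simpa using (atomEnd_lt_iff hα h hβ x n 0 0 0).2 (by simpa [hn'.neg_one_pow] using d0)
    rw [min_eq_right h1.le, max_eq_left h1.le] at hlen ⊢
    rw [arcIco_projC h1 hlen]

lemma Ini_subset (hα : Irrational α) (h : α ∈ Set.Ico (0 : ℝ) 1)
    (hβ : ∀ y : ℝ, Tendsto (fun n : ℕ => H.lift^[n] y / n) atTop (nhds (α + k)))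
    (x : ℝ) (n i : ℕ) :
    DynPart.Ini H α (projC x) n i ⊆
      projC '' Ico (min (H.lift^[i] x) (H.lift^[i] (atomEnd H α k x n 0)))
        (max (H.lift^[i] x) (H.lift^[i] (atomEnd H α k x n 0))) := by
  rw [DynPart.Ini, In_eq hα h hβ]
  rintro _ ⟨_, ⟨w, hw, rfl⟩, rfl⟩
  have hm := H.lift_iterate_strictMono i
  rw [← hm.monotone.map_min, ← hm.monotone.map_max]
  exact ⟨H.lift^[i] w, ⟨hm.monotone hw.1, hm hw.2⟩, (H.toFun_iterate_projC i w).symm⟩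

lemma atom_subset (hα : Irrational α) (h : α ∈ Set.Ico (0 : ℝ) 1)
    (hβ : ∀ y : ℝ, Tendsto (fun n : ℕ => H.lift^[n] y / n) atTop (nhds (α + k)))
    (x : ℝ) (n j : ℕ) :
    DynPart.Δ H α (projC x) (n + 1) 0 j ⊆
      projC '' Ico (min (atomEnd H α k x n j) (atomEnd H α k x n (j + 1)))
        (max (atomEnd H α k x n j) (atomEnd H α k x n (j + 1))) := by
  intro z hz
  obtain ⟨w, hw, rfl⟩ := Ini_subset hα h hβ x _ _ hz
  simp only [Nat.add_sub_cancel, Nat.zero_add] at hw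
  have e0 : atomEnd H α k x n j = H.lift^[cfQ α n + j * cfQ α (n + 1)] x +
    (-(cfNum α k n + j * cfNum α k (n + 1)) : ℤ) := rfl
  have e1 : atomEnd H α k x n (j + 1) =
      H.lift^[cfQ α n + j * cfQ α (n + 1)] (atomEnd H α k x (n + 1) 0) +
        (-(cfNum α k n + j * cfNum α k (n + 1)) : ℤ) := by
    rw [atomEnd_zero, H.lift_iterate_add_int, ← Function.iterate_add_apply, atomEnd,
      show cfQ α n + (j + 1) * cfQ α (n + 1) = cfQ α n + j * cfQ α (n + 1) + cfQ α (n + 1) by ring]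
    push_cast
    ring
  rw [e0, e1, min_add_add_right, max_add_add_right]
  exact ⟨w + (-(cfNum α k n + j * cfNum α k (n + 1)) : ℤ),
    ⟨by linarith [hw.1], by linarith [hw.2]⟩, projC_add_int _ _⟩

lemma cfDist_sub_pos (hα : Irrational α) (h : α ∈ Set.Ico (0 : ℝ) 1) (n : ℕ) {j : ℕ}
    (hj : j ≤ cfA α (n + 2)) : 0 < cfDist α n - j * cfDist α (n + 1) := by
  have h1 := cfDist_pos hα h.1 (n + 1)
  have h2 := cfDist_pos hα h.1 (n + 2)
  have hj' : (j : ℝ) ≤ cfA α (n + 2) := by exact_mod_cast hj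
  rw [cfDist_add_two hα h.1 n]
  nlinarith

lemma atomEnd_lt_atomEnd_iff (hα : Irrational α) (h : α ∈ Set.Ico (0 : ℝ) 1)
    (hβ : ∀ y : ℝ, Tendsto (fun n : ℕ => H.lift^[n] y / n) atTop (nhds (α + k)))
    (x : ℝ) (n : ℕ) {i j : ℕ} :
    atomEnd H α k x n i < atomEnd H α k x n j ↔ (-1 : ℝ) ^ n * j < (-1) ^ n * i := by
  have h1 := cfDist_pos hα h.1 (n + 1)
  conv_lhs => rhs; rw [atomEnd]
  rw [atomEnd_lt_iff hα h hβ, rotation_atomEnd hα h.1]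
  rw [← mul_lt_mul_iff_of_pos_right h1 (b := (-1 : ℝ) ^ n * j)]
  constructor <;> intro h2 <;> linarith

/-- The atoms `Δ_j`, `j < a_{n+2}`, lie on the same side of `x` as `I_n`, and are ordered. -/
lemma atomEnd_order (hα : Irrational α) (h : α ∈ Set.Ico (0 : ℝ) 1)
    (hβ : ∀ y : ℝ, Tendsto (fun n : ℕ => H.lift^[n] y / n) atTop (nhds (α + k)))
    (x : ℝ) (n : ℕ) :
    (StrictAnti (atomEnd H α k x n) ∧ ∀ j ≤ cfA α (n + 2), x < atomEnd H α k x n j) ∨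
    (StrictMono (atomEnd H α k x n) ∧ ∀ j ≤ cfA α (n + 2), atomEnd H α k x n j < x) := by
  rcases Nat.even_or_odd n with hn | hn
  · refine Or.inl ⟨fun i j hij => ?_, fun j hj => ?_⟩
    · rw [atomEnd_lt_atomEnd_iff hα h hβ]
      simpa [hn.neg_one_pow] using hij
    · simpa using (lt_atomEnd_iff hα h hβ x n j 0 0).2
        (by simpa [hn.neg_one_pow] using cfDist_sub_pos hα h n hj)
  · refine Or.inr ⟨fun i j hij => ?_, fun j hj => ?_⟩
    · rw [atomEnd_lt_atomEnd_iff hα h hβ]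
      simpa [hn.neg_one_pow] using hij
    · simpa using (atomEnd_lt_iff hα h hβ x n j 0 0).2
        (by simpa [hn.neg_one_pow] using cfDist_sub_pos hα h n hj)

lemma atom_subset_In (hα : Irrational α) (h : α ∈ Set.Ico (0 : ℝ) 1)
    (hβ : ∀ y : ℝ, Tendsto (fun n : ℕ => H.lift^[n] y / n) atTop (nhds (α + k)))
    (x : ℝ) (n : ℕ) {j : ℕ} (hj : j < cfA α (n + 2)) :
    DynPart.Δ H α (projC x) (n + 1) 0 j ⊆ DynPart.In H α (projC x) n := by
  refine (atom_subset hα h hβ x n j).trans ?_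
  rw [In_eq hα h hβ]
  refine image_mono (Ico_subset_Ico ?_ ?_)
  all_goals
    simp only [le_min_iff, max_le_iff, min_le_iff, le_max_iff]
    rcases atomEnd_order hα h hβ x n with ⟨hm, hx⟩ | ⟨hm, hx⟩
    · have h1 := hx (j + 1) hj
      have h2 := hx j hj.le
      have h4 := hm.antitone (Nat.zero_le j)
      have h5 := hm.antitone (Nat.zero_le (j + 1))
      grind
    · have h1 := hx (j + 1) hj
      have h2 := hx j hj.le
      have h4 := hm.monotone (Nat.zero_le j)
      have h5 := hm.monotone (Nat.zero_le (j + 1))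
      grind

/-- The arc `I_n` does not return to itself before time `q_{n+1}`. -/
lemma eq_zero_of_return (hα : Irrational α) (h : α ∈ Set.Ico (0 : ℝ) 1)
    (hβ : ∀ y : ℝ, Tendsto (fun n : ℕ => H.lift^[n] y / n) atTop (nhds (α + k)))
    (x : ℝ) (n : ℕ) {t : ℕ} (ht : t < cfQ α (n + 1)) {b : ℤ}
    (h1 : H.lift^[t] (min x (atomEnd H α k x n 0)) + b < max x (atomEnd H α k x n 0))
    (h2 : min x (atomEnd H α k x n 0) < H.lift^[t] (max x (atomEnd H α k x n 0)) + b) :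
    t = 0 := by
  by_contra ht0
  have hbest := cfDist_le_abs hα h k n (Nat.pos_of_ne_zero ht0) ht b
  have r3 := cfQ_mul_sub_cfNum hα h.1 k n
  have hx := fun (s : ℕ) (d : ℤ) => atomEnd_lt_iff hα h hβ x n 0 s d
  have hx' := fun (s : ℕ) (d : ℤ) => lt_atomEnd_iff hα h hβ x n 0 s d
  have e1 : H.lift^[t] (atomEnd H α k x n 0) + b
      = H.lift^[t + cfQ α n] x + (b - cfNum α k n : ℤ) := by
    rw [atomEnd_zero, H.lift_iterate_add_int, ← Function.iterate_add_apply]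
    push_cast
    ring
  have hzero : ∀ (s : ℕ) (d : ℤ), (H.lift^[s] x + d < x ↔ s * (α + k) + d < 0) ∧
      (x < H.lift^[s] x + d ↔ 0 < s * (α + k) + d) := by
    intro s d
    have g1 := CircleHomeo.orbit_lt_iff (hα.add_intCast k) hβ x (a := s) (c := 0) (b := d) (d := 0)
    have g2 := CircleHomeo.orbit_lt_iff (hα.add_intCast k) hβ x (a := 0) (c := s) (b := 0) (d := d)
    simpa using And.intro g1 g2
  refine absurd hbest (not_le.2 ?_)
  rcases atomEnd_order hα h hβ x n with ⟨hm, hxe⟩ | ⟨hm, hxe⟩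
  · have h3 := hxe 0 (Nat.zero_le _)
    rw [min_eq_left h3.le, max_eq_right h3.le] at h1 h2
    have hn : Even n := by
      by_contra hn
      have := (hx' 0 0).1 (by simpa using h3)
      simp [(Nat.not_even_iff_odd.1 hn).neg_one_pow] at this
      linarith [cfDist_pos hα h.1 n]
    rw [hx'] at h1
    rw [e1, (hzero _ _).2] at h2
    simp only [hn.neg_one_pow] at h1 h2 r3
    push_cast at h1 h2
    rw [abs_lt]
    constructor <;> linarith
  · have h3 := hxe 0 (Nat.zero_le _)
    rw [min_eq_right h3.le, max_eq_left h3.le] at h1 h2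
    have hn : Odd n := by
      by_contra hn
      have := (hx 0 0).1 (by simpa using h3)
      simp [(Nat.not_odd_iff_even.1 hn).neg_one_pow] at this
      linarith [cfDist_pos hα h.1 n]
    rw [hx] at h2
    rw [e1, (hzero _ _).1] at h1
    simp only [hn.neg_one_pow] at h1 h2 r3
    push_cast at h1 h2
    rw [abs_lt]
    constructor <;> linarith

end DynamicalPartition

section CriticalTimes

lemma exists_deriv_eq_zero_of_deriv_iterate {g : ℝ → ℝ} (hg : Differentiable ℝ g) {m : ℕ} {x : ℝ}
    (h : deriv g^[m] x = 0) : ∃ t < m, deriv g (g^[t] x) = 0 := by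
  induction m generalizing x with
  | zero => simp at h
  | succ m ih =>
    rw [Function.iterate_succ, deriv_comp x ((hg.iterate m) _) (hg _), mul_eq_zero] at h
    rcases h with h | h
    · obtain ⟨t, ht, h⟩ := ih h
      exact ⟨t + 1, by omega, h⟩
    · exact ⟨0, by omega, h⟩

lemma exists_crit_of_isCritPtOfIter {f : MulticriticalCircleMap} {m : ℕ} {y : ℝ}
    (h : IsCritPtOfIter f m (projC y)) :
    ∃ t < m, ∃ i, projC (f.lift^[t] y) = projC (f.crit i) := by
  obtain ⟨x, hxy, hx⟩ := h
  obtain ⟨b, rfl⟩ := exists_int_of_projC_eq hxy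
  obtain ⟨t, ht, h0⟩ :=
    exists_deriv_eq_zero_of_deriv_iterate (f.smooth.differentiable (by norm_num)) hx
  obtain ⟨i, k, hi⟩ := f.crit_complete _ h0
  refine ⟨t, ht, i, ?_⟩
  rw [f.lift_iterate_add_int] at hi
  rw [← projC_add_int _ b, hi, projC_add_int]

variable {H : CircleHomeo} {α : ℝ} {k : ℤ}

/-- The point `x` is not in the first `q_{n+1}` images of the interior of `I_n`. -/
lemma orbit_ne_of_mem_Ioo (hα : Irrational α) (h : α ∈ Set.Ico (0 : ℝ) 1)
    (hβ : ∀ y : ℝ, Tendsto (fun n : ℕ => H.lift^[n] y / n) atTop (nhds (α + k)))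
    {x y : ℝ} {n t : ℕ} (ht : t < cfQ α (n + 1))
    (hy : y ∈ Ioo (min x (atomEnd H α k x n 0)) (max x (atomEnd H α k x n 0))) :
    projC (H.lift^[t] y) ≠ projC x := by
  intro hp
  obtain ⟨b, hb⟩ := exists_int_of_projC_eq hp
  have hm := H.lift_iterate_strictMono t
  have h1 := hm hy.1
  have h2 := hm hy.2
  have ht0 : t = 0 := by
    refine eq_zero_of_return hα h hβ x n ht (b := -b) ?_ ?_
    · push_cast
      linarith [le_max_left x (atomEnd H α k x n 0)]
    · push_cast
      linarith [min_le_left x (atomEnd H α k x n 0)]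
  subst ht0
  simp only [Function.iterate_zero, id_eq] at hb
  have hlen := max_lt_min_add_one hα h hβ x n
  have hb0 : b = 0 := by
    have hl := le_max_left x (atomEnd H α k x n 0)
    have hr := min_le_left x (atomEnd H α k x n 0)
    rw [← Int.abs_lt_one_iff, abs_lt]
    have hb1 : (b : ℝ) < 1 := by linarith [hy.2]
    have hb2 : (-1 : ℝ) < b := by linarith [hy.1]
    exact ⟨by exact_mod_cast hb2, by exact_mod_cast hb1⟩
  subst hb0
  simp only [Int.cast_zero, add_zero] at hb
  subst hb
  rcases le_total y (atomEnd H α k y n 0) with hle | hle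
  · rw [min_eq_left hle] at hy
    exact lt_irrefl _ hy.1
  · rw [max_eq_left hle] at hy
    exact lt_irrefl _ hy.2

/-- A point has at most one preimage in the interior of `I_n` under the first `q_{n+1}` iterates. -/
lemma eq_of_orbit_eq (hα : Irrational α) (h : α ∈ Set.Ico (0 : ℝ) 1)
    (hβ : ∀ y : ℝ, Tendsto (fun n : ℕ => H.lift^[n] y / n) atTop (nhds (α + k)))
    {x y z : ℝ} {n t s : ℕ} (ht : t < cfQ α (n + 1)) (hs : s < cfQ α (n + 1))
    (hy : y ∈ Ioo (min x (atomEnd H α k x n 0)) (max x (atomEnd H α k x n 0)))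
    (hz : z ∈ Ioo (min x (atomEnd H α k x n 0)) (max x (atomEnd H α k x n 0)))
    (hp : projC (H.lift^[t] y) = projC (H.lift^[s] z)) : y = z := by
  wlog hts : s ≤ t generalizing s t y z
  · exact (this hs ht hz hy hp.symm (le_of_not_ge hts)).symm
  obtain ⟨b, hb⟩ := exists_int_of_projC_eq hp
  obtain ⟨r, rfl⟩ := Nat.exists_eq_add_of_le hts
  rw [Function.iterate_add_apply, ← H.lift_iterate_add_int] at hb
  have hb' := (H.lift_iterate_strictMono s).injective hb
  have hm := H.lift_iterate_strictMono r
  have h1 := hm hy.1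
  have h2 := hm hy.2
  have hr : r = 0 := by
    refine eq_zero_of_return hα h hβ x n (by omega) (b := -b) ?_ ?_
    · push_cast
      linarith [hz.2]
    · push_cast
      linarith [hz.1]
  subst hr
  simp only [Function.iterate_zero, id_eq] at hb'
  have hlen := max_lt_min_add_one hα h hβ x n
  have hb0 : b = 0 := by
    rw [← Int.abs_lt_one_iff, abs_lt]
    have hb1 : (b : ℝ) < 1 := by linarith [hy.2, hz.1]
    have hb2 : (-1 : ℝ) < b := by linarith [hz.2, hy.1]
    exact ⟨by exact_mod_cast hb2, by exact_mod_cast hb1⟩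
  simpa [hb0] using hb'

lemma card_critTimesSet_le {f : MulticriticalCircleMap}
    (hα : Irrational α) (h : α ∈ Set.Ico (0 : ℝ) 1)
    (hβ : ∀ y : ℝ, Tendsto (fun n : ℕ => f.lift^[n] y / n) atTop (nhds (α + k)))
    (i0 : Fin f.N) (n : ℕ) :
    (critTimesSet f α (projC (f.crit i0)) (n + 1)).card ≤ 2 * (f.N - 1) := by
  obtain ⟨x, hx⟩ : ∃ x, x = f.crit i0 := ⟨_, rfl⟩
  rw [← hx]
  let e := atomEnd f.toCircleHomeo α k x n
  have key : ∀ j ∈ critTimesSet f α (projC x) (n + 1),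
      ∃ i, ∃ t < cfQ α (n + 1), ∃ y ∈ Ioo (min x (e 0)) (max x (e 0)),
        y ∈ Icc (min (e j) (e (j + 1))) (max (e j) (e (j + 1))) ∧
        projC (f.lift^[t] y) = projC (f.crit i) := by
    intro j hj
    simp only [critTimesSet, Finset.mem_filter, Finset.mem_Ioo] at hj
    obtain ⟨⟨hj0, hja⟩, z, hz, hcrit⟩ := hj
    obtain ⟨y, hy, rfl⟩ := closure_projC_image_subset _ _
      (closure_mono (atom_subset hα h hβ x n j) hz)
    obtain ⟨t, ht, i, hi⟩ := exists_crit_of_isCritPtOfIter hcrit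
    refine ⟨i, t, ht, y, ?_, hy, hi⟩
    have hj1 : j + 1 ≤ cfA α (n + 2) := by
      change j < cfA α (n + 2) - 1 at hja
      omega
    rcases atomEnd_order hα h hβ x n with ⟨hm, hxe⟩ | ⟨hm, hxe⟩
    · have h0 := hm hj0
      have h1 := hm (Nat.lt_succ_self j)
      have h2 := hxe (j + 1) hj1
      simp only [Nat.succ_eq_add_one] at h1
      rw [min_eq_right h1.le, max_eq_left h1.le] at hy
      exact ⟨(min_le_left _ _).trans_lt (h2.trans_le hy.1),
        (hy.2.trans_lt h0).trans_le (le_max_right _ _)⟩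
    · have h0 := hm hj0
      have h1 := hm (Nat.lt_succ_self j)
      have h2 := hxe (j + 1) hj1
      simp only [Nat.succ_eq_add_one] at h1
      rw [min_eq_left h1.le, max_eq_right h1.le] at hy
      exact ⟨(min_le_right _ _).trans_lt (h0.trans_le hy.1),
        (hy.2.trans_lt h2).trans_le (le_max_left _ _)⟩
  have : Nonempty (Fin f.N) := ⟨i0⟩
  choose! c t ht y hyJ hyI hyc using key
  have hmaps : ∀ j ∈ critTimesSet f α (projC x) (n + 1), c j ∈ Finset.univ.erase i0 := by
    intro j hj
    refine Finset.mem_erase.2 ⟨fun hc => ?_, Finset.mem_univ _⟩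
    refine orbit_ne_of_mem_Ioo hα h hβ (ht j hj) (hyJ j hj) ?_
    rw [hyc j hj, hc, hx]
  have hclose : ∀ i ∈ critTimesSet f α (projC x) (n + 1),
      ∀ j ∈ critTimesSet f α (projC x) (n + 1), c i = c j → j ≤ i + 1 := by
    intro i hi j hj hc
    have hyy : y i = y j := by
      refine eq_of_orbit_eq hα h hβ (ht i hi) (ht j hj) (hyJ i hi) (hyJ j hj) ?_
      rw [hyc i hi, hyc j hj, hc]
    by_contra! hij
    have h1 := hyI i hi
    have h2 := hyI j hj
    rw [hyy] at h1
    rcases atomEnd_order hα h hβ x n with ⟨hm, -⟩ | ⟨hm, -⟩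
    · have g1 : e (i + 1) < e i := hm (Nat.lt_succ_self i)
      have g2 : e (j + 1) < e j := hm (Nat.lt_succ_self j)
      have g3 : e j < e (i + 1) := hm hij
      rw [min_eq_right g1.le] at h1
      rw [max_eq_left g2.le] at h2
      linarith [h1.1, h2.2]
    · have g1 : e i < e (i + 1) := hm (Nat.lt_succ_self i)
      have g2 : e j < e (j + 1) := hm (Nat.lt_succ_self j)
      have g3 : e (i + 1) < e j := hm hij
      rw [max_eq_right g1.le] at h1
      rw [min_eq_left g2.le] at h2
      linarith [h1.2, h2.1]
  have hcard := Finset.card_le_mul_card_image_of_maps_to hmaps 2 (fun i _ => ?_)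
  · simpa using hcard
  · rcases (Finset.filter (fun j => c j = i) (critTimesSet f α (projC x) (n + 1))).eq_empty_or_nonempty
      with hE | hE
    · simp [hE]
    · obtain ⟨m, hm, hmin⟩ := Finset.exists_min_image _ id hE
      calc _ ≤ (Finset.Icc m (m + 1)).card := by
            refine Finset.card_le_card fun j hj => ?_
            have h1 := hmin j hj
            rw [Finset.mem_filter] at hj hm
            exact Finset.mem_Icc.2 ⟨h1, hclose m hm.1 j hj.1 (hm.2.trans hj.2.symm)⟩
        _ ≤ 2 := by
            rw [Nat.card_Icc]
            omega

end CriticalTimes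

section Sums

lemma sum_Ioc_one_div_sq_le {m : ℕ} (hm : 0 < m) (K : ℕ) :
    ∑ t ∈ Finset.Ioc m K, 1 / (t : ℝ) ^ 2 ≤ 1 / (m : ℝ) := by
  rcases le_total m K with hK | hK
  · have h := sum_Ioc_inv_sq_le_sub (α := ℝ) hm.ne' hK
    simp only [one_div]
    have : (0 : ℝ) ≤ (K : ℝ)⁻¹ := by positivity
    linarith
  · rw [Finset.Ioc_eq_empty (by omega), Finset.sum_empty]
    positivity

lemma sum_one_div_min_sq_le {m a b : ℕ} (hm : 0 < m) :
    ∑ j ∈ Finset.Ioc (a + m) (b - m), 1 / ((min (j - a) (b - j) : ℕ) : ℝ) ^ 2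
      ≤ 2 / (m : ℝ) + 1 / (m : ℝ) ^ 2 := by
  have h1 : ∑ j ∈ Finset.Ioc (a + m) (b - m), 1 / ((j - a : ℕ) : ℝ) ^ 2 ≤ 1 / (m : ℝ) := by
    refine le_trans ?_ (sum_Ioc_one_div_sq_le hm b)
    have hinj : Set.InjOn (fun j => j - a) (Finset.Ioc (a + m) (b - m) : Set ℕ) := by
      intro i hi j hj hij
      simp only [Finset.coe_Ioc, Set.mem_Ioc] at hi hj hij
      omega
    rw [← Finset.sum_image (f := fun t : ℕ => 1 / (t : ℝ) ^ 2) hinj]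
    refine Finset.sum_le_sum_of_subset_of_nonneg ?_ fun _ _ _ => by positivity
    intro t ht
    simp only [Finset.mem_image, Finset.mem_Ioc] at ht ⊢
    omega
  have h2 : ∑ j ∈ Finset.Ioc (a + m) (b - m), 1 / ((b - j : ℕ) : ℝ) ^ 2
      ≤ 1 / (m : ℝ) + 1 / (m : ℝ) ^ 2 := by
    refine le_trans ?_ (add_le_add_left (sum_Ioc_one_div_sq_le hm b) _)
    have hinj : Set.InjOn (fun j => b - j) (Finset.Ioc (a + m) (b - m) : Set ℕ) := by
      intro i hi j hj hij
      simp only [Finset.coe_Ioc, Set.mem_Ioc] at hi hj hij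
      omega
    rw [← Finset.sum_image (f := fun t : ℕ => 1 / (t : ℝ) ^ 2) hinj,
      add_comm (∑ t ∈ Finset.Ioc m b, 1 / (t : ℝ) ^ 2),
      ← Finset.sum_insert (f := fun t : ℕ => 1 / (t : ℝ) ^ 2) (by simp : m ∉ Finset.Ioc m b)]
    refine Finset.sum_le_sum_of_subset_of_nonneg ?_ fun _ _ _ => by positivity
    intro t ht
    simp only [Finset.mem_image, Finset.mem_insert, Finset.mem_Ioc] at ht ⊢
    omega
  calc _ ≤ ∑ j ∈ Finset.Ioc (a + m) (b - m),
        (1 / ((j - a : ℕ) : ℝ) ^ 2 + 1 / ((b - j : ℕ) : ℝ) ^ 2) := by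
        refine Finset.sum_le_sum fun j _ => ?_
        rcases min_choice (j - a) (b - j) with h | h <;> rw [h]
        · exact le_add_of_nonneg_right (by positivity)
        · exact le_add_of_nonneg_left (by positivity)
    _ ≤ _ := by
        rw [Finset.sum_add_distrib]
        refine (add_le_add h1 h2).trans (le_of_eq ?_)
        ring

end Sums

section Bridges

lemma image_atom (H : CircleHomeo) (α : ℝ) (x0 : Circle1) (n i j : ℕ) :
    H.toFun^[i] '' DynPart.Δ H α x0 n 0 j = DynPart.Δ H α x0 n i j := by
  rw [DynPart.Δ, DynPart.Δ, DynPart.Ini, DynPart.Ini, ← image_comp, ← Function.iterate_add,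
    Nat.zero_add, ← add_assoc]

lemma kTime_le (f : MulticriticalCircleMap) (α : ℝ) (x0 : Circle1) (n s : ℕ) :
    kTime f α x0 n s ≤ cfA α (n + 1) - 1 := by
  rw [kTime, List.getD_eq_getElem?_getD]
  cases hg : ((0 :: (critTimesSet f α x0 n).sort (· ≤ ·)) ++ [cfA α (n + 1) - 1])[s]? with
  | none => simp
  | some v =>
    have hv := List.mem_of_getElem? hg
    simp only [List.mem_append, List.mem_cons, Finset.mem_sort, critTimesSet, Finset.mem_filter,
      Finset.mem_Ioo, List.not_mem_nil, or_false] at hv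
    simp only [Option.getD_some]
    omega

lemma mem_Ioc_of_lt_of_lt {a b j A : ℕ} {γ : ℝ} (h1 : (a : ℝ) + (A : ℝ) ^ γ < j)
    (h2 : (j : ℝ) < b + 1 - (A : ℝ) ^ γ) :
    j ∈ Finset.Ioc (a + ⌊(A : ℝ) ^ γ⌋₊) (b - ⌊(A : ℝ) ^ γ⌋₊) := by
  have h0 : (0 : ℝ) ≤ (A : ℝ) ^ γ := by positivity
  have hf := Nat.floor_le h0
  have h3 : a + ⌊(A : ℝ) ^ γ⌋₊ < j := by
    have : (a : ℝ) + ⌊(A : ℝ) ^ γ⌋₊ < j := by linarith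
    exact_mod_cast this
  have h4 : j + ⌊(A : ℝ) ^ γ⌋₊ < b + 1 := by
    have : (j : ℝ) + ⌊(A : ℝ) ^ γ⌋₊ < b + 1 := by linarith
    exact_mod_cast this
  rw [Finset.mem_Ioc]
  omega

lemma Aset_subset (f : MulticriticalCircleMap) (α : ℝ) (x0 : Circle1) (n i : ℕ) (γ : ℝ) :
    Aset f α x0 n i γ ⊆ ⋃ s ∈ Finset.range (rn f α x0 n),
      ⋃ j ∈ Finset.Ioc (kTime f α x0 n s + ⌊(cfA α (n + 1) : ℝ) ^ γ⌋₊)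
        (kTime f α x0 n (s + 1) - ⌊(cfA α (n + 1) : ℝ) ^ γ⌋₊),
        DynPart.Δ f.toCircleHomeo α x0 n i j := by
  intro z hz
  simp only [Aset, bridgeGamma, mem_iUnion, image_iUnion, image_atom, mem_Iio, mem_ofPred_eq,
    Finset.mem_range, exists_prop] at hz ⊢
  obtain ⟨s, hs, j, ⟨h1, h2⟩, hz⟩ := hz
  exact ⟨s, hs, j, mem_Ioc_of_lt_of_lt h1 h2, hz⟩

end Bridges

/-- If the atoms within the bridges satisfy the Yoccoz-type estimate
`M⁻¹|I_{n-1}^i|/min{j-k_s, k_{s+1}-j}² < |Δ^{(n)}_{i,j}| < M|I_{n-1}^i|/min{j-k_s, k_{s+1}-j}²`,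
then `|A^n_{i,γ}| ≤ (4N+2) M |I_{n-1}^i| / ⌊a_{n+1}^γ⌋`. -/
theorem stmt6 (f : MulticriticalCircleMap) (α : ℝ) (hirr : Irrational α)
    (hrot : HasRotationNumber f.toCircleHomeo α) (i0 : Fin f.N)
    (M : ℝ) (hM : 1 < M) (n : ℕ) (hn : 1 ≤ n)
    (hYoc : ∀ i < cfQ α n, ∀ s < rn f α (projC (f.crit i0)) n,
      ∀ j, kTime f α (projC (f.crit i0)) n s < j → j < kTime f α (projC (f.crit i0)) n (s + 1) →
        M⁻¹ * (volume (DynPart.Ini f.toCircleHomeo α (projC (f.crit i0)) (n - 1) i)).toReal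
            / ((min (j - kTime f α (projC (f.crit i0)) n s)
                (kTime f α (projC (f.crit i0)) n (s + 1) - j) : ℕ) : ℝ) ^ 2
          < (volume (DynPart.Δ f.toCircleHomeo α (projC (f.crit i0)) n i j)).toReal ∧
        (volume (DynPart.Δ f.toCircleHomeo α (projC (f.crit i0)) n i j)).toReal
          < M * (volume (DynPart.Ini f.toCircleHomeo α (projC (f.crit i0)) (n - 1) i)).toReal
            / ((min (j - kTime f α (projC (f.crit i0)) n s)
                (kTime f α (projC (f.crit i0)) n (s + 1) - j) : ℕ) : ℝ) ^ 2)
    (γ : ℝ) (hγ : γ ∈ Set.Ioo (0 : ℝ) 1) (i : ℕ) (hi : i < cfQ α n) :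
    (volume (Aset f α (projC (f.crit i0)) n i γ)).toReal
      ≤ (4 * f.N + 2) * M
          * (volume (DynPart.Ini f.toCircleHomeo α (projC (f.crit i0)) (n - 1) i)).toReal
          / (⌊(cfA α (n + 1) : ℝ) ^ γ⌋₊ : ℝ) := by
  obtain ⟨hα, β, hβα, hβ⟩ := hrot
  obtain ⟨k, rfl⟩ : ∃ k : ℤ, β = α + k := ⟨⌊β⌋, by rw [← hβα, Int.fract_add_floor]⟩
  obtain ⟨n, rfl⟩ := Nat.exists_eq_add_of_le' hn
  obtain ⟨x, hx⟩ : ∃ x, x = projC (f.crit i0) := ⟨_, rfl⟩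
  have hr : rn f α x (n + 1) ≤ 2 * (f.N - 1) + 1 := by
    rw [hx]
    exact Nat.add_le_add_right (card_critTimesSet_le hirr hα hβ i0 n) 1
  have hIn : ∀ j < cfA α (n + 2), DynPart.Δ f.toCircleHomeo α x (n + 1) 0 j ⊆
      DynPart.In f.toCircleHomeo α x n := by
    intro j hj
    rw [hx]
    exact atom_subset_In hirr hα hβ _ n hj
  rw [← hx] at hYoc ⊢
  simp only [Nat.add_sub_cancel] at hYoc ⊢
  have hsub := Aset_subset f α x (n + 1) i γ
  have hk := kTime_le f α x (n + 1)
  have hA : 0 < cfA α (n + 1 + 1) := cfA_succ_pos hirr hα (n + 1)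
  have hm : 0 < ⌊(cfA α (n + 1 + 1) : ℝ) ^ γ⌋₊ :=
    Nat.floor_pos.2 (Real.one_le_rpow (by exact_mod_cast hA) hγ.1.le)
  generalize ⌊(cfA α (n + 1 + 1) : ℝ) ^ γ⌋₊ = m at hsub hm ⊢
  have hI0 : 0 ≤ (volume (DynPart.Ini f.toCircleHomeo α x n i)).toReal := ENNReal.toReal_nonneg
  have hN : (1 : ℝ) ≤ f.N := by exact_mod_cast f.N_pos
  have hm' : (1 : ℝ) ≤ m := by exact_mod_cast hm
  have hr' : (rn f α x (n + 1) : ℝ) ≤ 2 * f.N - 1 := by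
    have := f.N_pos
    have h2 : rn f α x (n + 1) + 1 ≤ 2 * f.N := by omega
    have h3 : ((rn f α x (n + 1) + 1 : ℕ) : ℝ) ≤ (2 * f.N : ℕ) := by exact_mod_cast h2
    push_cast at h3
    linarith
  rcases le_total (m : ℝ) (4 * f.N + 2) with hmN | hmN
  · have hAI : Aset f α x (n + 1) i γ ⊆ DynPart.Ini f.toCircleHomeo α x n i := by
      refine hsub.trans (iUnion₂_subset fun s _ => iUnion₂_subset fun j hj => ?_)
      rw [← image_atom]
      refine image_mono (hIn j ?_)
      have := hk (s + 1)
      rw [Finset.mem_Ioc] at hj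
      change kTime f α x (n + 1) (s + 1) ≤ cfA α (n + 2) - 1 at this
      omega
    refine (ENNReal.toReal_mono (measure_ne_top _ _) (measure_mono hAI)).trans ?_
    rw [le_div_iff₀ (by linarith)]
    have : (m : ℝ) ≤ (4 * f.N + 2) * M := by nlinarith
    nlinarith
  · have hsum : (volume (Aset f α x (n + 1) i γ)).toReal ≤
        ∑ s ∈ Finset.range (rn f α x (n + 1)),
          M * (volume (DynPart.Ini f.toCircleHomeo α x n i)).toReal * (2 / m + 1 / m ^ 2) := by
      refine (ENNReal.toReal_mono (measure_ne_top _ _) (measure_mono hsub)).trans ?_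
      refine (measureReal_biUnion_finset_le _ _).trans (Finset.sum_le_sum fun s hs => ?_)
      refine (measureReal_biUnion_finset_le _ _).trans ?_
      refine le_trans ?_ (mul_le_mul_of_nonneg_left (sum_one_div_min_sq_le
        (a := kTime f α x (n + 1) s) (b := kTime f α x (n + 1) (s + 1)) hm) (by positivity))
      rw [Finset.mul_sum]
      refine Finset.sum_le_sum fun j hj => ?_
      rw [Finset.mem_Ioc] at hj
      rw [mul_one_div]
      exact (hYoc i hi s (Finset.mem_range.1 hs) j (by omega) (by omega)).2.le
    refine hsum.trans ?_
    rw [Finset.sum_const, Finset.card_range, nsmul_eq_mul]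
    have h1 : (rn f α x (n + 1) : ℝ) * (2 / m + 1 / m ^ 2) ≤ (4 * f.N + 2) / m := by
      have h2 : (2 / m + 1 / m ^ 2 : ℝ) = (2 + 1 / m) / m := by field_simp
      rw [h2, ← mul_div_assoc]
      refine div_le_div_of_nonneg_right ?_ (by linarith)
      have h3 : (1 / m : ℝ) * m = 1 := by field_simp
      have h4 : (0 : ℝ) < 1 / m := by positivity
      nlinarith
    calc _ = M * (volume (DynPart.Ini f.toCircleHomeo α x n i)).toReal *
          (rn f α x (n + 1) * (2 / m + 1 / m ^ 2)) := by ring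
      _ ≤ M * (volume (DynPart.Ini f.toCircleHomeo α x n i)).toReal * ((4 * f.N + 2) / m) :=
          mul_le_mul_of_nonneg_left h1 (by positivity)
      _ = _ := by ring
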